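/- arXiv:1701.05816 — 3 statements merged into one kernel-verified Lean document; each statement's English description precedes it below -/
import Mathlib

section
/- There exist polynomial maps f₁, f₂ : ℝ² → ℝ² sharing the common fixed point (0,0) which is locally asymptotically stable (LAS) for both f₁ and f₂, and such that (0,0) is a repeller for the composition map f₂ ∘ f₁. -/
open Filter Topology

/-- `p` is a locally asymptotically stable (LAS) fixed point of `f : ℝⁿ → ℝⁿ`. -/
def IsLAS {n : ℕ} (f : EuclideanSpace ℝ (Fin n) → EuclideanSpace ℝ (Fin n))
    (p : EuclideanSpace ℝ (Fin n)) : Prop :=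
  (∀ ε > 0, ∃ δ > 0, ∀ x, ‖x - p‖ < δ → ∀ k : ℕ, 1 ≤ k → ‖f^[k] x - p‖ < ε) ∧
  (∃ η > 0, ∀ x, ‖x - p‖ < η → Tendsto (fun k => f^[k] x) atTop (𝓝 p))

/-- `p` is a repeller fixed point of `f : ℝⁿ → ℝⁿ`. -/
def IsRepeller {n : ℕ} (f : EuclideanSpace ℝ (Fin n) → EuclideanSpace ℝ (Fin n))
    (p : EuclideanSpace ℝ (Fin n)) : Prop :=
  ∃ ε₀ > 0, ∀ ε : ℝ, 0 < ε → ε < ε₀ → ∀ x, x ≠ p → ‖x - p‖ < ε →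
    ∃ k : ℕ, ‖f^[k] x - p‖ > ε

/-- `f : ℝⁿ → ℝⁿ` is a polynomial map: each component is given by a polynomial
in the `n` coordinates. -/
def IsPolyMap {n : ℕ} (f : EuclideanSpace ℝ (Fin n) → EuclideanSpace ℝ (Fin n)) : Prop :=
  ∃ P : Fin n → MvPolynomial (Fin n) ℝ,
    ∀ x i, f x i = MvPolynomial.eval (fun j => x j) (P i)

section Lyapunov

/-- If `V` tends to `l` along an orbit of `f`, then `V w = V (f w) = l` at every cluster point `w`
of the orbit. -/
lemma MapClusterPt.apply_eq_of_tendsto_iterate {E : Type*} [TopologicalSpace E] {f : E → E}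
    {V : E → ℝ} (hf : Continuous f) (hV : Continuous V) {x w : E} {l : ℝ}
    (hl : Tendsto (fun k => V (f^[k] x)) atTop (𝓝 l))
    (hw : MapClusterPt w atTop fun k => f^[k] x) : V w = l ∧ V (f w) = l := by
  obtain ⟨U, hU, hUw⟩ := mapClusterPt_iff_ultrafilter.1 hw
  refine ⟨tendsto_nhds_unique ((hV.tendsto w).comp hUw) (hl.mono_left hU),
    tendsto_nhds_unique (((hV.comp hf).tendsto w).comp hUw) ?_⟩
  have h := (hl.comp (tendsto_add_atTop_nat 1)).mono_left hU
  exact h.congr fun k => congrArg V (Function.iterate_succ_apply' f k x)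

variable {n : ℕ} {f : EuclideanSpace ℝ (Fin n) → EuclideanSpace ℝ (Fin n)}
  {V : EuclideanSpace ℝ (Fin n) → ℝ} {r : ℝ}

/-- A fixed point with a strict Lyapunov function is locally asymptotically stable. -/
lemma IsLAS.of_lyapunov (hf : Continuous f) (hV : Continuous V) (hf0 : f 0 = 0) (hV0 : V 0 = 0)
    (hr : 0 < r) (hpos : ∀ x, x ≠ 0 → ‖x‖ < r → 0 < V x)
    (hdec : ∀ x, x ≠ 0 → ‖x‖ < r → V (f x) < V x) : IsLAS f 0 := by
  have hdec' : ∀ x, ‖x‖ < r → V (f x) ≤ V x := by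
    intro x hx
    rcases eq_or_ne x 0 with rfl | h
    · rw [hf0]
    · exact (hdec x h hx).le
  have key : ∀ ε > 0, ε < r → ∃ δ > 0, ∀ x, ‖x‖ < δ →
      ∀ k : ℕ, ‖f^[k] x‖ < ε ∧ V (f^[k + 1] x) ≤ V (f^[k] x) := by
    intro ε hε hεr
    obtain ⟨d, hd, hfd⟩ := Metric.continuousAt_iff.1 (hf.continuousAt (x := 0)) ε hε
    simp only [hf0, dist_zero_right] at hfd
    set d₁ := min d ε with hd₁
    have hd₁pos : 0 < d₁ := lt_min hd hε
    have hcomp : IsCompact (Metric.closedBall (0 : EuclideanSpace ℝ (Fin n)) ε ∩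
        {x | d₁ ≤ ‖x‖}) :=
      (isCompact_closedBall _ _).inter_right (isClosed_le continuous_const continuous_norm)
    obtain ⟨m, hm, hmV⟩ := hcomp.exists_forall_le' hV.continuousOn (a := 0) (by
      rintro x ⟨hx, hx'⟩
      rw [mem_closedBall_zero_iff] at hx
      exact hpos x (norm_pos_iff.1 (hd₁pos.trans_le hx')) (hx.trans_lt hεr))
    have hnear : ∀ᶠ x in 𝓝 (0 : EuclideanSpace ℝ (Fin n)), V x < m :=
      hV.continuousAt.eventually_lt continuousAt_const (by rwa [hV0])
    obtain ⟨e, he, hVe⟩ := Metric.eventually_nhds_iff.1 hnear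
    simp only [dist_zero_right] at hVe
    refine ⟨min d₁ e, lt_min hd₁pos he, fun x hx => ?_⟩
    have inv : ∀ k : ℕ, ‖f^[k] x‖ < d₁ ∧ V (f^[k] x) < m := by
      intro k
      induction k with
      | zero => exact ⟨hx.trans_le (min_le_left _ _), hVe (hx.trans_le (min_le_right _ _))⟩
      | succ k ih =>
        rw [Function.iterate_succ_apply']
        have h1 : ‖f (f^[k] x)‖ < ε := hfd (ih.1.trans_le (min_le_left _ _))
        have h2 : V (f (f^[k] x)) < m :=
          (hdec' _ ((ih.1.trans_le (min_le_right _ _)).trans hεr)).trans_lt ih.2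
        refine ⟨?_, h2⟩
        by_contra! h
        exact absurd (hmV _ ⟨mem_closedBall_zero_iff.2 h1.le, h⟩) (not_le.2 h2)
    intro k
    have h := (inv k).1.trans_le (min_le_right d ε)
    refine ⟨h, ?_⟩
    rw [Function.iterate_succ_apply']
    exact hdec' _ (h.trans hεr)
  constructor
  · intro ε hε
    obtain ⟨δ, hδ, h⟩ := key (min ε (r / 2)) (lt_min hε (half_pos hr))
      ((min_le_right _ _).trans_lt (half_lt_self hr))
    refine ⟨δ, hδ, fun x hx k _ => ?_⟩
    rw [sub_zero] at hx ⊢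
    exact (h x hx k).1.trans_le (min_le_left _ _)
  · obtain ⟨δ, hδ, h⟩ := key (r / 2) (half_pos hr) (half_lt_self hr)
    refine ⟨δ, hδ, fun x hx => ?_⟩
    rw [sub_zero] at hx
    have hlt : ∀ w ∈ Metric.closedBall (0 : EuclideanSpace ℝ (Fin n)) (r / 2), ‖w‖ < r :=
      fun w hw => (mem_closedBall_zero_iff.1 hw).trans_lt (half_lt_self hr)
    have hmem : ∀ k, f^[k] x ∈ Metric.closedBall 0 (r / 2) :=
      fun k => mem_closedBall_zero_iff.2 (h x hx k).1.le
    have hanti : Antitone fun k => V (f^[k] x) := antitone_nat_of_succ_le fun k => (h x hx k).2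
    have hbdd : BddBelow (Set.range fun k => V (f^[k] x)) :=
      ((isCompact_closedBall _ _).image hV).bddBelow.mono
        (Set.range_subset_iff.2 fun k => Set.mem_image_of_mem V (hmem k))
    refine (isCompact_closedBall _ _).tendsto_nhds_of_unique_mapClusterPt
      (Eventually.of_forall hmem) fun w hw hcl => ?_
    obtain ⟨h1, h2⟩ := hcl.apply_eq_of_tendsto_iterate hf hV (tendsto_atTop_ciInf hanti hbdd)
    by_contra hne
    exact (hdec w hne (hlt w hw)).ne (h2.trans h1.symm)

/-- A fixed point with a strictly increasing positive definite function is a repeller. -/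
lemma IsRepeller.of_lyapunov (hf : Continuous f) (hV : Continuous V) (hV0 : V 0 = 0)
    (hr : 0 < r) (hpos : ∀ x, x ≠ 0 → 0 < V x) (hf0 : f 0 = 0)
    (hinc : ∀ x, x ≠ 0 → ‖x‖ < r → V x < V (f x)) : IsRepeller f 0 := by
  refine ⟨r, hr, fun ε _ hεr x hx _ => ?_⟩
  by_contra! hbd
  simp only [sub_zero] at hbd
  have hmem : ∀ k, f^[k] x ∈ Metric.closedBall 0 ε := fun k => mem_closedBall_zero_iff.2 (hbd k)
  have hmono : Monotone fun k => V (f^[k] x) := by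
    refine monotone_nat_of_le_succ fun k => ?_
    rw [Function.iterate_succ_apply']
    rcases eq_or_ne (f^[k] x) 0 with h | h
    · rw [h, hf0]
    · exact (hinc _ h ((hbd k).trans_lt hεr)).le
  have hbdd : BddAbove (Set.range fun k => V (f^[k] x)) :=
    ((isCompact_closedBall _ _).image hV).bddAbove.mono
      (Set.range_subset_iff.2 fun k => Set.mem_image_of_mem V (hmem k))
  have hlim := tendsto_atTop_ciSup hmono hbdd
  obtain ⟨w, hw, hcl⟩ := (isCompact_closedBall (0 : EuclideanSpace ℝ (Fin n)) ε).exists_mapClusterPt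
    (f := atTop) (u := fun k => f^[k] x)
    (tendsto_principal.2 (Eventually.of_forall hmem))
  obtain ⟨h1, h2⟩ := hcl.apply_eq_of_tendsto_iterate hf hV hlim
  have hw0 : w ≠ 0 := by
    rintro rfl
    have h3 : V x ≤ V 0 := by
      rw [h1]
      exact le_ciSup hbdd 0
    linarith [hpos x hx]
  exact (hinc w hw0 ((mem_closedBall_zero_iff.1 hw).trans_lt hεr)).ne (h1.trans h2.symm)

end Lyapunov

lemma IsPolyMap.continuous {n : ℕ} {f : EuclideanSpace ℝ (Fin n) → EuclideanSpace ℝ (Fin n)}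
    (hf : IsPolyMap f) : Continuous f := by
  obtain ⟨P, hP⟩ := hf
  refine (PiLp.continuous_toLp 2 _).comp (continuous_pi (f := fun x i => f x i) fun i => ?_)
  simp only [hP]
  exact (MvPolynomial.continuous_eval (P i)).comp (PiLp.continuous_ofLp 2 _)

/-- The quadratic form invariant under `(x, y) ↦ (y, -x - y)`. -/
noncomputable def hexForm (x y : ℝ) : ℝ := x ^ 2 + x * y + y ^ 2

/-- The quartic part of `hexForm` along the cubic part of `spiral`. -/
noncomputable def quarticDrift (x y : ℝ) : ℝ :=
  (x ^ 2 + 4 * y ^ 2) * (x ^ 2 - y ^ 2 + hexForm x y / 5)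

/-- The first coordinate of the cubic perturbation of the identity. -/
noncomputable def spiralFst (x y : ℝ) : ℝ := x + (x ^ 2 + 4 * y ^ 2) * (x / 10 - y)

/-- The second coordinate of the cubic perturbation of the identity. -/
noncomputable def spiralSnd (x y : ℝ) : ℝ := y + (x ^ 2 + 4 * y ^ 2) * (x + y / 10)

/-- A cubic perturbation of the order-three linear map `(x, y) ↦ (y, -x - y)`. -/
noncomputable def spiral (p : EuclideanSpace ℝ (Fin 2)) : EuclideanSpace ℝ (Fin 2) :=
  !₂[spiralSnd (p 0) (p 1), -spiralFst (p 0) (p 1) - spiralSnd (p 0) (p 1)]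

/-- A contracting cubic perturbation of the linear map `(x, y) ↦ (-x - y, x)`. -/
noncomputable def shrink (p : EuclideanSpace ℝ (Fin 2)) : EuclideanSpace ℝ (Fin 2) :=
  !₂[(1 - hexForm (p 0) (p 1) / 100) * (-p 0 - p 1), (1 - hexForm (p 0) (p 1) / 100) * p 0]

/-- A Lyapunov function for `spiral`. -/
noncomputable def spiralLyapunov (x y : ℝ) : ℝ :=
  hexForm x y + (2 * quarticDrift x y + quarticDrift y (-x - y)) / 3

lemma isPolyMap_spiral : IsPolyMap spiral := by
  let X : MvPolynomial (Fin 2) ℝ := .X 0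
  let Y : MvPolynomial (Fin 2) ℝ := .X 1
  let F := X + (X ^ 2 + .C 4 * Y ^ 2) * (.C (1 / 10) * X - Y)
  let G := Y + (X ^ 2 + .C 4 * Y ^ 2) * (X + .C (1 / 10) * Y)
  refine ⟨![G, -F - G], fun x i => ?_⟩
  fin_cases i <;> simp [-mul_eq_mul_left_iff, -mul_eq_mul_right_iff, spiral, spiralFst,
    spiralSnd, X, Y, F, G] <;> ring

lemma isPolyMap_shrink : IsPolyMap shrink := by
  let X : MvPolynomial (Fin 2) ℝ := .X 0
  let Y : MvPolynomial (Fin 2) ℝ := .X 1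
  let H := 1 - .C (1 / 100) * (X ^ 2 + X * Y + Y ^ 2)
  refine ⟨![H * (-X - Y), H * X], fun x i => ?_⟩
  fin_cases i <;> simp [-mul_eq_mul_left_iff, -mul_eq_mul_right_iff, shrink, hexForm, X, Y, H] <;> ring

lemma spiral_zero : spiral 0 = 0 := by
  ext i
  fin_cases i <;> simp [spiral, spiralFst, spiralSnd]

lemma shrink_zero : shrink 0 = 0 := by
  ext i
  fin_cases i <;> simp [shrink, hexForm]

lemma sq_add_sq_pos_of_ne_zero {p : EuclideanSpace ℝ (Fin 2)} (hp : p ≠ 0) :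
    0 < p 0 ^ 2 + p 1 ^ 2 := by
  have h := EuclideanSpace.real_norm_sq_eq p
  rw [Fin.sum_univ_two] at h
  rw [← h]
  exact pow_pos (norm_pos_iff.2 hp) 2

lemma half_sq_add_sq_le_hexForm (x y : ℝ) : (x ^ 2 + y ^ 2) / 2 ≤ hexForm x y := by
  unfold hexForm
  nlinarith [sq_nonneg (x + y)]

lemma hexForm_le (x y : ℝ) : hexForm x y ≤ 3 / 2 * (x ^ 2 + y ^ 2) := by
  unfold hexForm
  nlinarith [sq_nonneg (x - y)]

lemma abs_mul_sub_mul_le {a b c d A B s t : ℝ} (ha : |a| ≤ A) (hd : |d| ≤ B)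
    (hac : |a - c| ≤ s) (hbd : |b - d| ≤ t) : |a * b - c * d| ≤ A * t + s * B := by
  have hA : 0 ≤ A := (abs_nonneg a).trans ha
  have hs : 0 ≤ s := (abs_nonneg _).trans hac
  calc |a * b - c * d| = |a * (b - d) + (a - c) * d| := by ring_nf
    _ ≤ |a * (b - d)| + |(a - c) * d| := abs_add_le _ _
    _ = |a| * |b - d| + |a - c| * |d| := by rw [abs_mul, abs_mul]
    _ ≤ A * t + s * B := by gcongr

lemma abs_quarticDrift_sub_le {x y X Y S t : ℝ} (hx : |x| ≤ S) (hy : |y| ≤ S) (hX : |X| ≤ S)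
    (hY : |Y| ≤ S) (hxX : |X - x| ≤ t) (hyY : |Y - y| ≤ t) :
    |quarticDrift X Y - quarticDrift x y| ≤ 38 * S ^ 3 * t := by
  have hmul : ∀ {a b : ℝ}, |a| ≤ S → |b| ≤ S → |a * b| ≤ S * S := fun ha hb => by
    rw [abs_mul]
    exact mul_le_mul ha hb (abs_nonneg _) ((abs_nonneg _).trans ha)
  have hxx := abs_mul_sub_mul_le hX hx hxX hxX
  have hxy := abs_mul_sub_mul_le hX hy hxX hyY
  have hyy := abs_mul_sub_mul_le hY hy hyY hyY
  have h40 := abs_mul_sub_mul_le (hmul hX hX) (hmul hx hx) hxx hxx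
  have h31 := abs_mul_sub_mul_le (hmul hX hX) (hmul hx hy) hxx hxy
  have h22 := abs_mul_sub_mul_le (hmul hX hX) (hmul hy hy) hxx hyy
  have h13 := abs_mul_sub_mul_le (hmul hX hY) (hmul hy hy) hxy hyy
  have h04 := abs_mul_sub_mul_le (hmul hY hY) (hmul hy hy) hyy hyy
  have hSt : 0 ≤ S ^ 3 * t :=
    mul_nonneg (pow_nonneg ((abs_nonneg x).trans hx) 3) ((abs_nonneg _).trans hxX)
  rw [abs_le] at h40 h31 h22 h13 h04 ⊢
  unfold quarticDrift hexForm
  constructor <;> linarith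

lemma abs_quarticDrift_le (x y : ℝ) : |quarticDrift x y| ≤ 6 * (x ^ 2 + y ^ 2) ^ 2 := by
  unfold quarticDrift hexForm
  rw [abs_le]
  constructor <;>
    nlinarith [sq_nonneg (x * y), sq_nonneg (x ^ 2), sq_nonneg (y ^ 2), sq_nonneg (x * (x + y)),
      sq_nonneg (x * (x - y)), sq_nonneg (y * (x + y)), sq_nonneg (y * (x - y))]

lemma spiralLyapunov_pos {x y : ℝ} (h0 : 0 < x ^ 2 + y ^ 2) (h : x ^ 2 + y ^ 2 ≤ 1 / 100) :
    0 < spiralLyapunov x y := by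
  have h1 := (abs_le.1 (abs_quarticDrift_le x y)).1
  have h2 := (abs_le.1 (abs_quarticDrift_le y (-x - y))).1
  have h3 : y ^ 2 + (-x - y) ^ 2 ≤ 3 * (x ^ 2 + y ^ 2) := by
    nlinarith [sq_nonneg (x - y), sq_nonneg x]
  have h4 : (y ^ 2 + (-x - y) ^ 2) ^ 2 ≤ (3 * (x ^ 2 + y ^ 2)) ^ 2 := by gcongr
  have h5 := half_sq_add_sq_le_hexForm x y
  unfold spiralLyapunov
  nlinarith

lemma spiralLyapunov_spiral_lt {x y : ℝ} (h0 : 0 < x ^ 2 + y ^ 2)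
    (h : x ^ 2 + y ^ 2 ≤ (1 / 400) ^ 2) :
    spiralLyapunov (spiralSnd x y) (-spiralFst x y - spiralSnd x y) < spiralLyapunov x y := by
  obtain ⟨s, hs, hs2⟩ : ∃ s : ℝ, 0 < s ∧ s ^ 2 = x ^ 2 + y ^ 2 :=
    ⟨√(x ^ 2 + y ^ 2), Real.sqrt_pos.2 h0, Real.sq_sqrt h0.le⟩
  have hs1 : s ≤ 1 / 400 := abs_le_of_sq_le_sq' (by rwa [hs2]) (by norm_num) |>.2
  have hx : |x| ≤ s := abs_le_of_sq_le_sq (by nlinarith [sq_nonneg y]) hs.le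
  have hy : |y| ≤ s := abs_le_of_sq_le_sq (by nlinarith [sq_nonneg x]) hs.le
  set X := spiralFst x y with hX
  set Y := spiralSnd x y with hY
  set Q := x ^ 2 + 4 * y ^ 2 with hQ
  have hQ0 : 0 ≤ Q := by positivity
  have hQs : Q ≤ 4 * s ^ 2 := by nlinarith [sq_nonneg x]
  have hcube : ∀ m : ℝ, |m| ≤ 11 / 10 * s → |Q * m| ≤ 9 / 2 * s ^ 3 := by
    intro m hm
    rw [abs_mul, abs_of_nonneg hQ0]
    calc Q * |m| ≤ 4 * s ^ 2 * (11 / 10 * s) := by gcongr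
      _ ≤ 9 / 2 * s ^ 3 := by nlinarith [pow_pos hs 3]
  have hXx : |X - x| ≤ 9 / 2 * s ^ 3 := by
    rw [show X - x = Q * (x / 10 - y) by rw [hX, spiralFst]; ring]
    apply hcube
    rw [abs_le] at *
    constructor <;> linarith
  have hYy : |Y - y| ≤ 9 / 2 * s ^ 3 := by
    rw [show Y - y = Q * (x + y / 10) by rw [hY, spiralSnd]; ring]
    apply hcube
    rw [abs_le] at *
    constructor <;> linarith
  have hs3 : 9 / 2 * s ^ 3 ≤ s / 2 := by
    have : s ^ 2 ≤ 1 / 9 := by nlinarith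
    nlinarith
  have hs3' : 0 < s ^ 3 := by positivity
  have hD₁ : |quarticDrift Y (-X - Y) - quarticDrift y (-x - y)| ≤
      38 * (3 * s) ^ 3 * (9 * s ^ 3) := by
    rw [abs_le] at hx hy hXx hYy
    apply abs_quarticDrift_sub_le <;> rw [abs_le] <;> constructor <;> linarith
  have hD₂ : |quarticDrift (-X - Y) X - quarticDrift (-x - y) x| ≤
      38 * (3 * s) ^ 3 * (9 * s ^ 3) := by
    rw [abs_le] at hx hy hXx hYy
    apply abs_quarticDrift_sub_le <;> rw [abs_le] <;> constructor <;> linarith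
  have hid : spiralLyapunov Y (-X - Y) - spiralLyapunov x y =
      -hexForm x y ^ 2 / 3 + Q ^ 2 * hexForm (x / 10 - y) (x + y / 10) +
      (2 * (quarticDrift Y (-X - Y) - quarticDrift y (-x - y)) +
        (quarticDrift (-X - Y) X - quarticDrift (-x - y) x)) / 3 := by
    have h1 : hexForm Y (-X - Y) =
        hexForm x y + quarticDrift x y + Q ^ 2 * hexForm (x / 10 - y) (x + y / 10) := by
      rw [hX, hY, hQ]
      unfold spiralFst spiralSnd quarticDrift hexForm
      ring
    have h2 : quarticDrift x y + quarticDrift y (-x - y) + quarticDrift (-x - y) x =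
        -hexForm x y ^ 2 := by
      unfold quarticDrift hexForm
      ring
    have h3 : -Y - (-X - Y) = X := by ring
    simp only [spiralLyapunov, h1, h3]
    linarith
  have hm : hexForm (x / 10 - y) (x + y / 10) ≤ 2 * s ^ 2 := by
    refine (hexForm_le _ _).trans ?_
    rw [hs2]
    nlinarith
  have hQm : Q ^ 2 * hexForm (x / 10 - y) (x + y / 10) ≤ (4 * s ^ 2) ^ 2 * (2 * s ^ 2) :=
    mul_le_mul (pow_le_pow_left₀ hQ0 hQs 2) hm
      (le_trans (by positivity) (half_sq_add_sq_le_hexForm _ _)) (by positivity)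
  have hN : (s ^ 2 / 2) ^ 2 ≤ hexForm x y ^ 2 :=
    pow_le_pow_left₀ (by positivity) (hs2 ▸ half_sq_add_sq_le_hexForm x y) 2
  have h6 : s ^ 6 ≤ (1 / 400) ^ 2 * s ^ 4 := by
    rw [show s ^ 6 = s ^ 2 * s ^ 4 by ring]
    gcongr
  have h4 : 0 < s ^ 4 := by positivity
  linarith [(abs_le.1 hD₁).2, (abs_le.1 hD₂).2]

lemma isLAS_spiral : IsLAS spiral 0 := by
  refine IsLAS.of_lyapunov (V := fun p => spiralLyapunov (p 0) (p 1)) (r := 1 / 400)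
    isPolyMap_spiral.continuous ?_ spiral_zero ?_ (by norm_num) ?_ ?_
  · unfold spiralLyapunov quarticDrift hexForm
    fun_prop
  · simp [spiralLyapunov, quarticDrift, hexForm]
  all_goals
    intro p hp hr
    have hn := EuclideanSpace.real_norm_sq_eq p
    rw [Fin.sum_univ_two] at hn
    have hb : p 0 ^ 2 + p 1 ^ 2 ≤ (1 / 400) ^ 2 := hn ▸ pow_le_pow_left₀ (norm_nonneg p) hr.le 2
  · exact spiralLyapunov_pos (sq_add_sq_pos_of_ne_zero hp) (hb.trans (by norm_num))
  · simpa [spiral] using spiralLyapunov_spiral_lt (sq_add_sq_pos_of_ne_zero hp) hb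

lemma hexForm_shrink (p : EuclideanSpace ℝ (Fin 2)) :
    hexForm (shrink p 0) (shrink p 1) =
      (1 - hexForm (p 0) (p 1) / 100) ^ 2 * hexForm (p 0) (p 1) := by
  simp [shrink, hexForm]
  ring

lemma isLAS_shrink : IsLAS shrink 0 := by
  have hpos : ∀ p : EuclideanSpace ℝ (Fin 2), p ≠ 0 → 0 < hexForm (p 0) (p 1) := fun p hp =>
    (half_pos (sq_add_sq_pos_of_ne_zero hp)).trans_le (half_sq_add_sq_le_hexForm _ _)
  refine IsLAS.of_lyapunov (V := fun p => hexForm (p 0) (p 1)) (r := 1)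
    isPolyMap_shrink.continuous ?_ shrink_zero ?_ one_pos (fun p hp _ => hpos p hp) ?_
  · unfold hexForm
    fun_prop
  · simp [hexForm]
  · intro p hp hr
    have hn := EuclideanSpace.real_norm_sq_eq p
    rw [Fin.sum_univ_two] at hn
    have hb : p 0 ^ 2 + p 1 ^ 2 ≤ 1 ^ 2 := hn ▸ pow_le_pow_left₀ (norm_nonneg p) hr.le 2
    have h1 := hexForm_le (p 0) (p 1)
    have h2 := hpos p hp
    simp only [hexForm_shrink]
    refine mul_lt_of_lt_one_left h2 ?_
    nlinarith

lemma shrink_comp_spiral (p : EuclideanSpace ℝ (Fin 2)) :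
    let X := spiralFst (p 0) (p 1)
    let Y := spiralSnd (p 0) (p 1)
    (shrink ∘ spiral) p = !₂[(1 - hexForm X Y / 100) * X, (1 - hexForm X Y / 100) * Y] := by
  ext i
  fin_cases i <;> simp [-mul_eq_mul_left_iff, -mul_eq_mul_right_iff, shrink, spiral, hexForm] <;> ring

lemma sq_add_sq_lt_shrink_spiral {x y : ℝ} (h0 : 0 < x ^ 2 + y ^ 2)
    (h : x ^ 2 + y ^ 2 ≤ 1 / 100) :
    x ^ 2 + y ^ 2 < ((1 - hexForm (spiralFst x y) (spiralSnd x y) / 100) * spiralFst x y) ^ 2 +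
      ((1 - hexForm (spiralFst x y) (spiralSnd x y) / 100) * spiralSnd x y) ^ 2 := by
  set X := spiralFst x y with hX
  set Y := spiralSnd x y with hY
  set v := x ^ 2 + y ^ 2 with hv
  set Q := x ^ 2 + 4 * y ^ 2 with hQ
  have hvQ : v ≤ Q := by nlinarith [sq_nonneg y]
  have hQv : Q ≤ 4 * v := by nlinarith [sq_nonneg x]
  set W := (1 + Q / 10) ^ 2 + Q ^ 2 with hW
  have hXY : X ^ 2 + Y ^ 2 = W * v := by
    rw [hX, hY, hW, hv, spiralFst, spiralSnd]
    ring
  have hW1 : 1 + v / 5 ≤ W := by nlinarith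
  have hW2 : W ≤ 2 := by nlinarith
  have hN : hexForm X Y ≤ 3 * v := by
    have := hexForm_le X Y
    rw [hXY] at this
    nlinarith
  have hlam : 1 - 3 / 50 * v ≤ (1 - hexForm X Y / 100) ^ 2 := by
    nlinarith [sq_nonneg (hexForm X Y)]
  rw [mul_pow, mul_pow, ← mul_add, hXY, ← mul_assoc]
  refine lt_mul_of_one_lt_left h0 ?_
  calc 1 < (1 - 3 / 50 * v) * (1 + v / 5) := by nlinarith
    _ ≤ (1 - hexForm X Y / 100) ^ 2 * W :=
      mul_le_mul hlam hW1 (by positivity) (by positivity)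

lemma isRepeller_shrink_comp_spiral : IsRepeller (shrink ∘ spiral) 0 := by
  refine IsRepeller.of_lyapunov (V := fun p => p 0 ^ 2 + p 1 ^ 2) (r := 1 / 10)
    (isPolyMap_shrink.continuous.comp isPolyMap_spiral.continuous) (by fun_prop) (by simp)
    (by norm_num) (fun p hp => sq_add_sq_pos_of_ne_zero hp)
    (by rw [Function.comp_apply, spiral_zero, shrink_zero]) fun p hp hr => ?_
  have hn := EuclideanSpace.real_norm_sq_eq p
  rw [Fin.sum_univ_two] at hn
  have hb : p 0 ^ 2 + p 1 ^ 2 ≤ (1 / 10) ^ 2 := hn ▸ pow_le_pow_left₀ (norm_nonneg p) hr.le 2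
  have h := sq_add_sq_lt_shrink_spiral (sq_add_sq_pos_of_ne_zero hp) (hb.trans (by norm_num))
  simp only [shrink_comp_spiral]
  exact h

/-- there are two planar polynomial maps fixing the origin, which is LAS
for both, but a repeller for the composition `f₂ ∘ f₁`. -/
theorem stmt4 :
    ∃ f₁ f₂ : EuclideanSpace ℝ (Fin 2) → EuclideanSpace ℝ (Fin 2),
      IsPolyMap f₁ ∧ IsPolyMap f₂ ∧ f₁ 0 = 0 ∧ f₂ 0 = 0 ∧
      IsLAS f₁ 0 ∧ IsLAS f₂ 0 ∧ IsRepeller (f₂ ∘ f₁) 0 :=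
  ⟨spiral, shrink, isPolyMap_spiral, isPolyMap_shrink, spiral_zero, shrink_zero, isLAS_spiral,
    isLAS_shrink, isRepeller_shrink_comp_spiral⟩
end

section
/- There exist polynomial maps f₁, f₂ : ℝ² → ℝ² sharing the common fixed point (0,0) which is a repeller for both f₁ and f₂, and such that (0,0) is locally asymptotically stable (LAS) for the composition map f₂ ∘ f₁. -/
open Filter Topology

lemma add_mul_le_iterate_sq {α : Type*} {f : α → α} {g : α → ℝ} {c : ℝ} (hc : 0 < c) {x : α}
    (h : ∀ k, g (f^[k + 1] x) = g (f^[k] x) + c * g (f^[k] x) ^ 3) (k : ℕ) :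
    g x ^ 2 + k * (2 * c * g x ^ 4) ≤ g (f^[k] x) ^ 2 := by
  induction k with
  | zero => simp
  | succ k ih =>
    rw [h k]
    set u := g (f^[k] x)
    have h1 : g x ^ 2 ≤ u ^ 2 := le_trans (le_add_of_nonneg_right (by positivity)) ih
    have h2 : (g x ^ 2) ^ 2 ≤ (u ^ 2) ^ 2 := by gcongr
    have h3 : 0 ≤ c ^ 2 * (u ^ 3) ^ 2 := by positivity
    have h4 : 2 * c * (g x ^ 2) ^ 2 ≤ 2 * c * (u ^ 2) ^ 2 := by gcongr
    push_cast
    nlinarith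

lemma exists_lt_iterate_sq {α : Type*} {f : α → α} {g : α → ℝ} {c : ℝ} (hc : 0 < c) {x : α}
    (hx : g x ≠ 0) (h : ∀ k, g (f^[k + 1] x) = g (f^[k] x) + c * g (f^[k] x) ^ 3) (B : ℝ) :
    ∃ k : ℕ, B < g (f^[k] x) ^ 2 := by
  have hpos : 0 < 2 * c * g x ^ 4 := by positivity
  obtain ⟨k, hk⟩ := exists_nat_gt (B / (2 * c * g x ^ 4))
  rw [div_lt_iff₀ hpos] at hk
  exact ⟨k, by nlinarith [add_mul_le_iterate_sq hc h k, sq_nonneg (g x)]⟩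

/-- The origin is a repeller when one coordinate `g` grows cubically under `f`, and a
complementary coordinate `h` grows cubically on the line `g = 0`. -/
lemma isRepeller_zero_of_cubic_growth {n : ℕ}
    {f : EuclideanSpace ℝ (Fin n) → EuclideanSpace ℝ (Fin n)}
    {g h : EuclideanSpace ℝ (Fin n) → ℝ} {c : ℝ} (hc : 0 < c)
    (hg : ∀ x, g (f x) = g x + c * g x ^ 3)
    (hh : ∀ x, g x = 0 → h (f x) = h x + c * h x ^ 3)
    (h0 : ∀ x, g x = 0 → h x = 0 → x = 0)
    (hgb : ∀ x, g x ^ 2 ≤ 2 * ‖x‖ ^ 2) (hhb : ∀ x, h x ^ 2 ≤ 2 * ‖x‖ ^ 2) :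
    IsRepeller f 0 := by
  refine ⟨1, one_pos, fun ε hε _ x hx _ => ?_⟩
  have hgs (k : ℕ) : g (f^[k + 1] x) = g (f^[k] x) + c * g (f^[k] x) ^ 3 := by
    rw [Function.iterate_succ_apply', hg]
  obtain ⟨k, hk⟩ : ∃ k : ℕ, 2 * ε ^ 2 < 2 * ‖f^[k] x‖ ^ 2 := by
    by_cases hgx : g x = 0
    · have hgk (k : ℕ) : g (f^[k] x) = 0 := by
        induction k with
        | zero => exact hgx
        | succ k ih => rw [hgs, ih]; ring
      obtain ⟨k, hk⟩ := exists_lt_iterate_sq (f := f) hc (fun hhx => hx (h0 x hgx hhx))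
        (fun k => by rw [Function.iterate_succ_apply', hh _ (hgk k)]) (2 * ε ^ 2)
      exact ⟨k, hk.trans_le (hhb _)⟩
    · obtain ⟨k, hk⟩ := exists_lt_iterate_sq hc hgx hgs (2 * ε ^ 2)
      exact ⟨k, hk.trans_le (hgb _)⟩
  refine ⟨k, ?_⟩
  rw [sub_zero]
  exact lt_of_pow_lt_pow_left₀ 2 (norm_nonneg _) (by linarith)

lemma tendsto_zero_of_le_sub_sq {a : ℕ → ℝ} (h0 : ∀ k, 0 ≤ a k)
    (h : ∀ k, a (k + 1) ≤ a k - a k ^ 2) : Tendsto a atTop (𝓝 0) := by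
  have hanti : Antitone a := antitone_nat_of_succ_le fun k => by nlinarith [h k, sq_nonneg (a k)]
  have hlim := tendsto_atTop_ciInf hanti ⟨0, by rintro _ ⟨k, rfl⟩; exact h0 k⟩
  have hle := le_of_tendsto_of_tendsto' (hlim.comp (tendsto_add_atTop_nat 1))
    (hlim.sub (hlim.pow 2)) h
  have : (⨅ k, a k) = 0 := by nlinarith [sq_nonneg (⨅ k, a k)]
  rwa [this] at hlim

lemma isLAS_zero_of_norm_sq_le {n : ℕ}
    {f : EuclideanSpace ℝ (Fin n) → EuclideanSpace ℝ (Fin n)} {ρ : ℝ} (hρ : 0 < ρ)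
    (h : ∀ x, ‖x‖ < ρ → ‖f x‖ ^ 2 ≤ ‖x‖ ^ 2 - (‖x‖ ^ 2) ^ 2) : IsLAS f 0 := by
  have hle (x) (hx : ‖x‖ < ρ) : ‖f x‖ ≤ ‖x‖ :=
    le_of_sq_le_sq (by nlinarith [h x hx, sq_nonneg (‖x‖ ^ 2)]) (norm_nonneg _)
  have hit (x) (hx : ‖x‖ < ρ) (k : ℕ) : ‖f^[k] x‖ ≤ ‖x‖ := by
    induction k with
    | zero => rfl
    | succ k ih =>
      rw [Function.iterate_succ_apply']
      exact (hle _ (ih.trans_lt hx)).trans ih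
  refine ⟨fun ε hε => ⟨min ε ρ, lt_min hε hρ, fun x hx k _ => ?_⟩, ρ, hρ, fun x hx => ?_⟩
  · rw [sub_zero] at hx ⊢
    exact (hit x (hx.trans_le (min_le_right _ _)) k).trans_lt (hx.trans_le (min_le_left _ _))
  · rw [sub_zero] at hx
    have hsq := tendsto_zero_of_le_sub_sq (a := fun k => ‖f^[k] x‖ ^ 2) (fun k => sq_nonneg _)
      fun k => by
        simp only [Function.iterate_succ_apply']
        exact h _ ((hit x hx k).trans_lt hx)
    rw [tendsto_zero_iff_norm_tendsto_zero]
    simpa using hsq.sqrt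

/-- A map growing cubically along the axes and contracting along the diagonals. -/
noncomputable def axisMap (x : EuclideanSpace ℝ (Fin 2)) : EuclideanSpace ℝ (Fin 2) :=
  !₂[x 0 + x 0 ^ 3, x 1 + x 1 ^ 3 - 14 * x 0 ^ 2 * x 1]

/-- The conjugate of `axisMap` by the rotation of angle `π / 4`: in the coordinates
`s = x + y`, `d = x - y` it is `(s, d) ↦ (s + s ^ 3 / 2, d + d ^ 3 / 2 - 7 * s ^ 2 * d)`. -/
noncomputable def diagonalMap (x : EuclideanSpace ℝ (Fin 2)) : EuclideanSpace ℝ (Fin 2) :=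
  !₂[((x 0 + x 1) + (x 0 + x 1) ^ 3 / 2 +
      ((x 0 - x 1) + (x 0 - x 1) ^ 3 / 2 - 7 * (x 0 + x 1) ^ 2 * (x 0 - x 1))) / 2,
    ((x 0 + x 1) + (x 0 + x 1) ^ 3 / 2 -
      ((x 0 - x 1) + (x 0 - x 1) ^ 3 / 2 - 7 * (x 0 + x 1) ^ 2 * (x 0 - x 1))) / 2]

lemma norm_sq_fin_two (x : EuclideanSpace ℝ (Fin 2)) : ‖x‖ ^ 2 = x 0 ^ 2 + x 1 ^ 2 := by
  rw [EuclideanSpace.real_norm_sq_eq, Fin.sum_univ_two]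

lemma isPolyMap_axisMap : IsPolyMap axisMap := by
  refine ⟨![.X 0 + .X 0 ^ 3, .X 1 + .X 1 ^ 3 - .C 14 * .X 0 ^ 2 * .X 1], fun x i => ?_⟩
  fin_cases i <;> simp [axisMap]

lemma isPolyMap_diagonalMap : IsPolyMap diagonalMap := by
  refine ⟨![.C (1 / 2) * ((.X 0 + .X 1) + .C (1 / 2) * (.X 0 + .X 1) ^ 3 +
      ((.X 0 - .X 1) + .C (1 / 2) * (.X 0 - .X 1) ^ 3 - .C 7 * (.X 0 + .X 1) ^ 2 * (.X 0 - .X 1))),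
    .C (1 / 2) * ((.X 0 + .X 1) + .C (1 / 2) * (.X 0 + .X 1) ^ 3 -
      ((.X 0 - .X 1) + .C (1 / 2) * (.X 0 - .X 1) ^ 3 -
        .C 7 * (.X 0 + .X 1) ^ 2 * (.X 0 - .X 1)))], fun x i => ?_⟩
  fin_cases i <;> simp [diagonalMap] <;> ring

lemma isRepeller_axisMap : IsRepeller axisMap 0 := by
  refine isRepeller_zero_of_cubic_growth (g := fun x => x 0) (h := fun x => x 1) one_pos
    (fun x => by simp [axisMap]) (fun x hx => by simp [axisMap, hx])
    (fun x h0 h1 => ?_) (fun x => ?_) (fun x => ?_)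
  · ext i
    fin_cases i <;> assumption
  all_goals
    rw [norm_sq_fin_two]
    nlinarith [sq_nonneg (x 0), sq_nonneg (x 1)]

lemma isRepeller_diagonalMap : IsRepeller diagonalMap 0 := by
  refine isRepeller_zero_of_cubic_growth (g := fun x => x 0 + x 1) (h := fun x => x 0 - x 1)
    one_half_pos (fun x => by simp [diagonalMap]; ring) (fun x hx => ?_)
    (fun x h0 h1 => ?_) (fun x => ?_) (fun x => ?_)
  · simp [diagonalMap, hx]
    ring
  · ext i
    fin_cases i <;> simp <;> linarith
  all_goals
    rw [norm_sq_fin_two]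
    nlinarith [sq_nonneg (x 0 - x 1), sq_nonneg (x 0 + x 1)]

lemma norm_sq_axisMap_le (x : EuclideanSpace ℝ (Fin 2)) :
    ‖axisMap x‖ ^ 2 ≤
      ‖x‖ ^ 2 + 2 * (‖x‖ ^ 2) ^ 2 - 32 * (x 0 ^ 2 * x 1 ^ 2) + 197 * (‖x‖ ^ 2) ^ 3 := by
  simp only [norm_sq_fin_two, axisMap]
  simp
  have hX := sq_nonneg (x 0)
  have hY := sq_nonneg (x 1)
  have hXY := mul_nonneg hX hY
  nlinarith [mul_nonneg hX hXY, mul_nonneg hY hXY, pow_nonneg hX 3, pow_nonneg hY 3]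

lemma norm_sq_diagonalMap_le (x : EuclideanSpace ℝ (Fin 2)) :
    ‖diagonalMap x‖ ^ 2 ≤
      ‖x‖ ^ 2 + 2 * (‖x‖ ^ 2) ^ 2 - 8 * (x 0 ^ 2 - x 1 ^ 2) ^ 2 + 197 * (‖x‖ ^ 2) ^ 3 := by
  simp only [norm_sq_fin_two, diagonalMap]
  simp
  have hS := sq_nonneg (x 0 + x 1)
  have hD := sq_nonneg (x 0 - x 1)
  have hSD := mul_nonneg hS hD
  nlinarith [mul_nonneg hS hSD, mul_nonneg hD hSD, pow_nonneg hS 3, pow_nonneg hD 3]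

lemma sq_sub_sq_axisMap_ge (x : EuclideanSpace ℝ (Fin 2)) (hx : ‖x‖ ^ 2 ≤ 1 / 10000) :
    (x 0 ^ 2 - x 1 ^ 2) ^ 2 - 80 * (‖x‖ ^ 2) ^ 3 ≤
      (axisMap x 0 ^ 2 - axisMap x 1 ^ 2) ^ 2 := by
  rw [norm_sq_fin_two] at *
  simp only [axisMap]
  simp
  have h0 : (x 0 + x 0 ^ 3) ^ 2 = x 0 ^ 2 * (1 + x 0 ^ 2) ^ 2 := by ring
  have h1 : (x 1 + x 1 ^ 3 - 14 * x 0 ^ 2 * x 1) ^ 2 =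
      x 1 ^ 2 * (1 + x 1 ^ 2 - 14 * x 0 ^ 2) ^ 2 := by ring
  rw [h0, h1]
  have hX := sq_nonneg (x 0)
  have hY := sq_nonneg (x 1)
  generalize x 0 ^ 2 = X at *
  generalize x 1 ^ 2 = Y at *
  set e := X * (1 + X) ^ 2 - Y * (1 + Y - 14 * X) ^ 2 - (X - Y) with he
  have hXY := mul_nonneg hX hY
  have hexp : e = 2 * X ^ 2 + X ^ 3 - 2 * Y ^ 2 + 28 * (X * Y) - Y * (Y - 14 * X) ^ 2 := by
    rw [he]
    ring
  have hX3 : X ^ 3 ≤ X ^ 2 := pow_le_pow_of_le_one hX (by linarith) (by norm_num)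
  have hX3' : 0 ≤ X ^ 3 := pow_nonneg hX 3
  have hT : Y * (Y - 14 * X) ^ 2 ≤ 196 * (X + Y) ^ 2 / 10 := by
    calc Y * (Y - 14 * X) ^ 2 ≤ (1 / 10000) * (196 * (X + Y) ^ 2) := by
          gcongr
          · linarith
          · nlinarith
      _ ≤ _ := by nlinarith [sq_nonneg (X + Y)]
  have hT' : 0 ≤ Y * (Y - 14 * X) ^ 2 := by positivity
  have hle : |e| ≤ 40 * (X + Y) ^ 2 := by
    rw [abs_le, hexp]
    constructor <;> nlinarith
  have habs : |X - Y| ≤ X + Y := abs_le.2 ⟨by linarith, by linarith⟩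
  have hprod : |(X - Y) * e| ≤ (X + Y) * (40 * (X + Y) ^ 2) := by
    rw [abs_mul]
    gcongr
  have : X * (1 + X) ^ 2 - Y * (1 + Y - 14 * X) ^ 2 = (X - Y) + e := by rw [he]; ring
  rw [this]
  nlinarith [(abs_le.1 hprod).1, sq_nonneg e]

lemma norm_sq_diagonalMap_axisMap_le (x : EuclideanSpace ℝ (Fin 2)) (hx : ‖x‖ < 1 / 100) :
    ‖diagonalMap (axisMap x)‖ ^ 2 ≤ ‖x‖ ^ 2 - (‖x‖ ^ 2) ^ 2 := by
  have hN : ‖x‖ ^ 2 ≤ 1 / 10000 := by nlinarith [norm_nonneg x]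
  have h1 := norm_sq_axisMap_le x
  have h2 := norm_sq_diagonalMap_le (axisMap x)
  have h3 := sq_sub_sq_axisMap_ge x hN
  have hsq : (‖x‖ ^ 2) ^ 2 = (x 0 ^ 2 - x 1 ^ 2) ^ 2 + 4 * (x 0 ^ 2 * x 1 ^ 2) := by
    rw [norm_sq_fin_two]; ring
  have hp : 0 ≤ x 0 ^ 2 * x 1 ^ 2 := by positivity
  have hN0 := sq_nonneg ‖x‖
  have hM0 := sq_nonneg ‖axisMap x‖
  generalize ‖x‖ ^ 2 = N at *
  generalize ‖axisMap x‖ ^ 2 = M at *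
  have hN3 : N ^ 3 ≤ N ^ 2 / 10000 := by nlinarith [sq_nonneg N]
  have hM : M ≤ N * (1 + 1 / 1000) := by nlinarith
  have hM2 : M ^ 2 ≤ (N * (1 + 1 / 1000)) ^ 2 := by gcongr
  have hM3 : M ^ 3 ≤ (N * (1 + 1 / 1000)) ^ 3 := by gcongr
  nlinarith [sq_nonneg N]

/-- there are two planar polynomial maps fixing the origin, which is a
repeller for both, but LAS for the composition `f₂ ∘ f₁`. -/
theorem stmt5 :
    ∃ f₁ f₂ : EuclideanSpace ℝ (Fin 2) → EuclideanSpace ℝ (Fin 2),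
      IsPolyMap f₁ ∧ IsPolyMap f₂ ∧ f₁ 0 = 0 ∧ f₂ 0 = 0 ∧
      IsRepeller f₁ 0 ∧ IsRepeller f₂ 0 ∧ IsLAS (f₂ ∘ f₁) 0 := by
  refine ⟨axisMap, diagonalMap, isPolyMap_axisMap, isPolyMap_diagonalMap, ?_, ?_,
    isRepeller_axisMap, isRepeller_diagonalMap,
    isLAS_zero_of_norm_sq_le (ρ := 1 / 100) (by norm_num) norm_sq_diagonalMap_axisMap_le⟩
  · ext i
    fin_cases i <;> simp [axisMap]
  · ext i
    fin_cases i <;> simp [diagonalMap]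
end

section
/- For every integer n ≥ 1 and every integer k ≥ 3 there exist polynomial maps f₁, …, f_k : ℝⁿ → ℝⁿ sharing the common fixed point 0 which is locally asymptotically stable (LAS) for each f_i and such that 0 is a repeller for the composition f_k ∘ ⋯ ∘ f₁; and there also exist polynomial maps g₁, …, g_k : ℝⁿ → ℝⁿ sharing the common fixed point 0 which is a repeller for each g_i and such that 0 is LAS for the composition g_k ∘ ⋯ ∘ g₁. -/
open Filter Topology

/-- The composition `f k ∘ f (k-1) ∘ ⋯ ∘ f 1` (indices shifted to `Fin k`). -/
def compAll {α : Type*} {k : ℕ} (f : Fin k → α → α) : α → α :=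
  fun x => (List.ofFn f).foldl (fun y g => g y) x

open Polynomial

section Lyapunov

variable {E : Type*} [NormedAddCommGroup E]

lemma exists_norm_eq_of_tendsto_norm_iterate [ProperSpace E] {φ : E → E} (hφ : Continuous φ)
    {x : E} {L : ℝ}
    (h : Tendsto (fun k => ‖φ^[k] x‖) atTop (𝓝 L)) : ∃ y, ‖y‖ = L ∧ ‖φ y‖ = L := by
  obtain ⟨y, -, σ, hσ, hy⟩ :=
    tendsto_subseq_of_bounded (x := fun k => φ^[k] x) (s := Set.range fun k => φ^[k] x)
      (by
        obtain ⟨C, hC⟩ := h.bddAbove_range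
        refine isBounded_iff_forall_norm_le.2 ⟨C, ?_⟩
        rintro _ ⟨k, rfl⟩
        exact hC ⟨k, rfl⟩)
      (fun k => ⟨k, rfl⟩)
  refine ⟨y, tendsto_nhds_unique hy.norm (h.comp hσ.tendsto_atTop), ?_⟩
  refine tendsto_nhds_unique ((hφ.tendsto y).comp hy).norm ?_
  have := (h.comp (tendsto_add_atTop_nat 1)).comp hσ.tendsto_atTop
  refine this.congr fun k => ?_
  simp [Function.iterate_succ_apply']

lemma norm_iterate_le {φ : E → E} (hφ₀ : φ 0 = 0) {δ : ℝ}
    (hlt : ∀ x, x ≠ 0 → ‖x‖ < δ → ‖φ x‖ < ‖x‖) {x : E} (hx : ‖x‖ < δ) (k : ℕ) :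
    ‖φ^[k + 1] x‖ ≤ ‖φ^[k] x‖ ∧ ‖φ^[k] x‖ ≤ ‖x‖ := by
  have step : ∀ y, ‖y‖ < δ → ‖φ y‖ ≤ ‖y‖ := fun y hy => by
    by_cases h : y = 0
    · simp [h, hφ₀]
    · exact (hlt y h hy).le
  have hle : ‖φ^[k] x‖ ≤ ‖x‖ := by
    induction k with
    | zero => simp
    | succ k ih =>
      rw [Function.iterate_succ_apply']
      exact (step _ (ih.trans_lt hx)).trans ih
  refine ⟨?_, hle⟩
  rw [Function.iterate_succ_apply']
  exact step _ (hle.trans_lt hx)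

lemma tendsto_iterate_zero [ProperSpace E] {φ : E → E} (hφ : Continuous φ) (hφ₀ : φ 0 = 0) {δ : ℝ}
    (hlt : ∀ x, x ≠ 0 → ‖x‖ < δ → ‖φ x‖ < ‖x‖) {x : E} (hx : ‖x‖ < δ) :
    Tendsto (fun k => φ^[k] x) atTop (𝓝 0) := by
  have hanti : Antitone fun k => ‖φ^[k] x‖ :=
    antitone_nat_of_succ_le fun k => (norm_iterate_le hφ₀ hlt hx k).1
  have hlim := tendsto_atTop_ciInf hanti ⟨0, by rintro _ ⟨k, rfl⟩; exact norm_nonneg _⟩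
  obtain ⟨y, hy, hφy⟩ := exists_norm_eq_of_tendsto_norm_iterate hφ hlim
  have hyδ : ‖y‖ < δ := by
    rw [hy]
    exact (le_of_tendsto' hlim fun k => (norm_iterate_le hφ₀ hlt hx k).2).trans_lt hx
  have hy0 : y = 0 := by
    by_contra h
    have := hlt y h hyδ
    rw [hy, hφy] at this
    exact lt_irrefl _ this
  rw [tendsto_zero_iff_norm_tendsto_zero]
  rwa [← hy, hy0, norm_zero] at hlim

lemma exists_norm_iterate_gt [ProperSpace E] {φ : E → E} (hφ : Continuous φ) {δ : ℝ}
    (hlt : ∀ x, x ≠ 0 → ‖x‖ < δ → ‖x‖ < ‖φ x‖) {ε : ℝ} (hε : ε < δ) {x : E} (hx : x ≠ 0) :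
    ∃ k, ε < ‖φ^[k] x‖ := by
  by_contra! hle
  have hpos : ∀ k, φ^[k] x ≠ 0 := fun k => by
    induction k with
    | zero => simpa
    | succ k ih =>
      rw [Function.iterate_succ_apply']
      exact norm_pos_iff.1 ((norm_nonneg _).trans_lt (hlt _ ih ((hle k).trans_lt hε)))
  have hmono : Monotone fun k => ‖φ^[k] x‖ := monotone_nat_of_le_succ fun k => by
    rw [Function.iterate_succ_apply']
    exact (hlt _ (hpos k) ((hle k).trans_lt hε)).le
  have hlim := tendsto_atTop_ciSup hmono ⟨ε, by rintro _ ⟨k, rfl⟩; exact hle k⟩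
  obtain ⟨y, hy, hφy⟩ := exists_norm_eq_of_tendsto_norm_iterate hφ hlim
  have hyδ : ‖y‖ < δ := by
    rw [hy]
    exact (le_of_tendsto' hlim hle).trans_lt hε
  have hy0 : y ≠ 0 := by
    rw [← norm_pos_iff, hy]
    exact (norm_pos_iff.2 hx).trans_le (hmono.ge_of_tendsto hlim 0)
  have := hlt y hy0 hyδ
  rw [hy, hφy] at this
  exact lt_irrefl _ this

end Lyapunov

section Criteria

variable {n : ℕ} {f : EuclideanSpace ℝ (Fin n) → EuclideanSpace ℝ (Fin n)}

lemma isLAS_of_norm_lt (hf : Continuous f) (hf₀ : f 0 = 0) {δ : ℝ} (hδ : 0 < δ)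
    (hlt : ∀ x, x ≠ 0 → ‖x‖ < δ → ‖f^[2] x‖ < ‖x‖) : IsLAS f 0 := by
  have hφ₀ : f^[2] 0 = 0 := by simp [hf₀]
  let M : EuclideanSpace ℝ (Fin n) → ℝ := fun y => max ‖y‖ ‖f y‖
  have hM : Tendsto M (𝓝 0) (𝓝 0) := by
    have : Continuous M := continuous_norm.max hf.norm
    simpa [M, hf₀] using this.tendsto 0
  have hle : ∀ x k, ‖f^[k] x‖ ≤ M ((f^[2])^[k / 2] x) := fun x k => by
    rw [← Function.iterate_mul]
    rcases Nat.even_or_odd' k with ⟨j, rfl | rfl⟩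
    · simp [M]
    · have : (2 * j + 1) / 2 = j := by omega
      rw [this, Function.iterate_succ_apply']
      exact le_max_right _ _
  refine ⟨fun ε hε => ?_, δ, hδ, fun x hx => ?_⟩
  · obtain ⟨r, hr, hrM⟩ := Metric.eventually_nhds_iff.1 (hM.eventually_lt_const hε)
    refine ⟨min r δ, lt_min hr hδ, fun x hx k _ => ?_⟩
    rw [sub_zero] at hx ⊢
    refine (hle x k).trans_lt (hrM ?_)
    rw [dist_zero_right]
    exact (norm_iterate_le hφ₀ hlt (hx.trans_le (min_le_right _ _)) _).2.trans_lt
      (hx.trans_le (min_le_left _ _))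
  · rw [sub_zero] at hx
    rw [tendsto_zero_iff_norm_tendsto_zero]
    refine squeeze_zero (fun _ => norm_nonneg _) (hle x) (hM.comp ?_)
    exact (tendsto_iterate_zero (hf.iterate 2) hφ₀ hlt hx).comp
      (Nat.tendsto_div_const_atTop two_ne_zero)

lemma isRepeller_of_lt_norm (hf : Continuous f) {δ : ℝ} (hδ : 0 < δ)
    (hlt : ∀ x, x ≠ 0 → ‖x‖ < δ → ‖x‖ < ‖f^[2] x‖) : IsRepeller f 0 := by
  refine ⟨δ, hδ, fun ε _ hε x hx _ => ?_⟩
  obtain ⟨k, hk⟩ := exists_norm_iterate_gt (hf.iterate 2) hlt hε hx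
  refine ⟨2 * k, ?_⟩
  rwa [Function.iterate_mul, sub_zero]

end Criteria

section Diagonal

/-- The map of `ℝⁿ` applying the polynomial `p` to each coordinate. -/
noncomputable def diagMap (n : ℕ) (p : ℝ[X]) (x : EuclideanSpace ℝ (Fin n)) :
    EuclideanSpace ℝ (Fin n) :=
  WithLp.toLp 2 fun i => p.eval (x i)

variable {n : ℕ}

@[simp] lemma diagMap_apply (p : ℝ[X]) (x : EuclideanSpace ℝ (Fin n)) (i : Fin n) :
    diagMap n p x i = p.eval (x i) := rfl

lemma diagMap_comp (p q : ℝ[X]) : diagMap n (p.comp q) = diagMap n p ∘ diagMap n q := by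
  ext x i
  simp

lemma continuous_diagMap (p : ℝ[X]) : Continuous (diagMap n p) := by
  unfold diagMap
  fun_prop

lemma isPolyMap_diagMap (p : ℝ[X]) : IsPolyMap (diagMap n p) := by
  refine ⟨fun i => aeval (MvPolynomial.X i) p, fun x i => ?_⟩
  rw [← MvPolynomial.coe_aeval_eq_eval, RingHom.coe_coe, ← Polynomial.aeval_algHom_apply]
  simp [Polynomial.aeval_def, Polynomial.eval₂_id]

lemma diagMap_zero {p : ℝ[X]} (hp : p.eval 0 = 0) : diagMap n p 0 = 0 := by
  ext i
  simp [hp]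

lemma norm_lt_norm_of_abs_apply {x y : EuclideanSpace ℝ (Fin n)}
    (h : ∀ i, |x i| ≤ |y i|) (hlt : ∃ i, |x i| < |y i|) : ‖x‖ < ‖y‖ := by
  rw [EuclideanSpace.norm_eq, EuclideanSpace.norm_eq]
  obtain ⟨i, hi⟩ := hlt
  exact Real.sqrt_lt_sqrt (by positivity) (Finset.sum_lt_sum
    (fun j _ => pow_le_pow_left₀ (abs_nonneg _) (h j) 2)
    ⟨i, Finset.mem_univ i, pow_lt_pow_left₀ hi (abs_nonneg _) two_ne_zero⟩)

lemma exists_apply_ne_zero {x : EuclideanSpace ℝ (Fin n)} (hx : x ≠ 0) : ∃ i, x i ≠ 0 := by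
  by_contra! h
  exact hx (by ext i; simp [h i])

lemma isLAS_diagMap {p : ℝ[X]} (hp : p.eval 0 = 0)
    (h : ∀ᶠ x in 𝓝[≠] (0 : ℝ), |(p.comp p).eval x| < |x|) : IsLAS (diagMap n p) 0 := by
  obtain ⟨δ, hδ, hlt⟩ := Metric.eventually_nhds_iff.1 (eventually_nhdsWithin_iff.1 h)
  refine isLAS_of_norm_lt (continuous_diagMap p) (diagMap_zero hp) hδ fun x hx hxδ => ?_
  have key : ∀ i, x i ≠ 0 → |(diagMap n p)^[2] x i| < |x i| := fun i hi => by
    have hi' : dist (x i) 0 < δ := by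
      rw [dist_zero_right]
      exact (PiLp.norm_apply_le x i).trans_lt hxδ
    simpa using hlt hi' hi
  refine norm_lt_norm_of_abs_apply (fun i => ?_) ((exists_apply_ne_zero hx).imp key)
  by_cases hi : x i = 0
  · simp [hi, hp]
  · exact (key i hi).le

lemma isRepeller_diagMap {p : ℝ[X]}
    (h : ∀ᶠ x in 𝓝[≠] (0 : ℝ), |x| < |(p.comp p).eval x|) : IsRepeller (diagMap n p) 0 := by
  obtain ⟨δ, hδ, hlt⟩ := Metric.eventually_nhds_iff.1 (eventually_nhdsWithin_iff.1 h)
  refine isRepeller_of_lt_norm (continuous_diagMap p) hδ fun x hx hxδ => ?_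
  have key : ∀ i, x i ≠ 0 → |x i| < |(diagMap n p)^[2] x i| := fun i hi => by
    have hi' : dist (x i) 0 < δ := by
      rw [dist_zero_right]
      exact (PiLp.norm_apply_le x i).trans_lt hxδ
    simpa using hlt hi' hi
  refine norm_lt_norm_of_abs_apply (fun i => ?_) ((exists_apply_ne_zero hx).imp key)
  by_cases hi : x i = 0
  · simp [hi]
  · exact (key i hi).le

end Diagonal

section Jets

lemma X_pow_dvd_of_aeval_eq_zero {m : ℕ} {P : ℝ[X]}
    (h : ∀ (A : Type) [CommRing A] [Algebra ℝ A] (x : A), x ^ m = 0 → aeval x P = 0) :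
    X ^ m ∣ P := by
  rw [← AdjoinRoot.mk_eq_zero, ← AdjoinRoot.aeval_eq]
  refine h _ _ ?_
  rw [← AdjoinRoot.mk_X, ← map_pow, AdjoinRoot.mk_self]

lemma exists_eval_eq {m : ℕ} {a : ℝ} {P : ℝ[X]}
    (h : X ^ (m + 2) ∣ P - (X - C a * X ^ (m + 1))) :
    ∃ s : ℝ[X], s.eval 0 = a ∧ ∀ x, P.eval x = x * (1 - x ^ m * s.eval x) := by
  obtain ⟨r, hr⟩ := h
  refine ⟨C a - X * r, by simp, fun x => ?_⟩
  have := congrArg (eval x) hr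
  simp only [eval_sub, eval_mul, eval_pow, eval_X, eval_C] at this ⊢
  linear_combination this

lemma eventually_abs_eval_lt {m : ℕ} (hm : Even m) (hm₀ : m ≠ 0) {a : ℝ} (ha : 0 < a) {P : ℝ[X]}
    (h : X ^ (m + 2) ∣ P - (X - C a * X ^ (m + 1))) :
    ∀ᶠ x in 𝓝[≠] (0 : ℝ), |P.eval x| < |x| := by
  obtain ⟨s, hs, hP⟩ := exists_eval_eq h
  have hpos : ∀ᶠ x in 𝓝 (0 : ℝ), 0 < s.eval x :=
    s.continuous.continuousAt.eventually (lt_mem_nhds (by simpa [hs]))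
  have hlt : ∀ᶠ x in 𝓝 (0 : ℝ), x ^ m * s.eval x < 1 := by
    have hc : Continuous fun x : ℝ => x ^ m * s.eval x := by fun_prop
    exact hc.continuousAt.eventually (gt_mem_nhds (by simp [hm₀]))
  filter_upwards [hpos.filter_mono nhdsWithin_le_nhds, hlt.filter_mono nhdsWithin_le_nhds,
    self_mem_nhdsWithin] with x h₁ h₂ (hx : x ≠ 0)
  have h₃ := mul_pos (hm.pow_pos hx) h₁
  rw [hP, abs_mul]
  refine mul_lt_of_lt_one_right (abs_pos.2 hx) ?_
  rw [abs_lt]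
  constructor <;> linarith

lemma eventually_lt_abs_eval {m : ℕ} (hm : Even m) {a : ℝ} (ha : a < 0) {P : ℝ[X]}
    (h : X ^ (m + 2) ∣ P - (X - C a * X ^ (m + 1))) :
    ∀ᶠ x in 𝓝[≠] (0 : ℝ), |x| < |P.eval x| := by
  obtain ⟨s, hs, hP⟩ := exists_eval_eq h
  have hneg : ∀ᶠ x in 𝓝 (0 : ℝ), s.eval x < 0 :=
    s.continuous.continuousAt.eventually (gt_mem_nhds (by simpa [hs]))
  filter_upwards [hneg.filter_mono nhdsWithin_le_nhds, self_mem_nhdsWithin] with x h₁ (hx : x ≠ 0)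
  have h₂ := mul_neg_of_pos_of_neg (hm.pow_pos hx) h₁
  rw [hP, abs_mul]
  refine lt_mul_of_one_lt_right (abs_pos.2 hx) (lt_abs.2 (Or.inl ?_))
  linarith

end Jets

section Family

/-- Polynomials tangent to `±x`, each an involution to some order and perturbed at a higher odd
order by a term proportional to `c`, whose composition has a perturbation of the opposite sign. -/
noncomputable def parrondo (c : ℝ) : ℕ → ℝ[X]
  | 0 => -X + C c * X ^ 5
  | 1 => -X + X ^ 2 - X ^ 3 + X ^ 4 - X ^ 5 + C c * X ^ 5
  | 2 => -X - 4 * C c * X ^ 4 + C c * X ^ 5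
  | _ + 3 => X - C c * X ^ 7

/-- The composition of the first `m + 3` members of the family `parrondo c`. -/
noncomputable def parrondoComp (c : ℝ) : ℕ → ℝ[X]
  | 0 => (parrondo c 2).comp ((parrondo c 1).comp (parrondo c 0))
  | m + 1 => (parrondo c 3).comp (parrondoComp c m)

lemma eval_zero_parrondo (c : ℝ) (i : ℕ) : (parrondo c i).eval 0 = 0 := by
  rcases i with _ | _ | _ | i <;> simp [parrondo]

lemma eval_zero_parrondoComp (c : ℝ) (m : ℕ) : (parrondoComp c m).eval 0 = 0 := by
  induction m with
  | zero => simp [parrondoComp, eval_zero_parrondo]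
  | succ m ih => simp [parrondoComp, ih, eval_zero_parrondo]

lemma X_pow_dvd_parrondo (c : ℝ) (i : ℕ) : ∃ m, Even m ∧ m ≠ 0 ∧
    X ^ (m + 2) ∣ (parrondo c i).comp (parrondo c i) - (X - C (2 * c) * X ^ (m + 1)) := by
  rcases i with _ | _ | _ | i
  · refine ⟨4, by decide, by decide, X_pow_dvd_of_aeval_eq_zero fun A _ _ x hx => ?_⟩
    simp only [parrondo, map_sub, map_add, map_neg, map_mul, map_pow, map_ofNat, aeval_comp,
      aeval_X, aeval_C]
    generalize algebraMap ℝ A c = a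
    grind
  · refine ⟨4, by decide, by decide, X_pow_dvd_of_aeval_eq_zero fun A _ _ x hx => ?_⟩
    simp only [parrondo, map_sub, map_add, map_neg, map_mul, map_pow, map_ofNat, aeval_comp,
      aeval_X, aeval_C]
    generalize algebraMap ℝ A c = a
    grind
  · refine ⟨4, by decide, by decide, X_pow_dvd_of_aeval_eq_zero fun A _ _ x hx => ?_⟩
    simp only [parrondo, map_sub, map_add, map_neg, map_mul, map_pow, map_ofNat, aeval_comp,
      aeval_X, aeval_C]
    generalize algebraMap ℝ A c = a
    grind
  · refine ⟨6, by decide, by decide, X_pow_dvd_of_aeval_eq_zero fun A _ _ x hx => ?_⟩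
    simp only [parrondo, map_sub, map_mul, map_pow, map_ofNat, aeval_comp, aeval_X, aeval_C]
    generalize algebraMap ℝ A c = a
    grind

lemma aeval_parrondoComp {A : Type*} [CommRing A] [Algebra ℝ A] (c : ℝ) (m : ℕ) {x : A}
    (hx : x ^ 6 = 0) :
    aeval x (parrondoComp c m) = -x - x ^ 2 - x ^ 3 - (1 + 4 * algebraMap ℝ A c) * x ^ 4
      - (1 + 13 * algebraMap ℝ A c) * x ^ 5 := by
  induction m with
  | zero =>
    have h₁ : aeval x ((parrondo c 1).comp (parrondo c 0)) =
        x + x ^ 2 + x ^ 3 + x ^ 4 + (1 - 2 * algebraMap ℝ A c) * x ^ 5 := by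
      simp only [parrondo, map_sub, map_add, map_neg, map_mul, map_pow, aeval_comp, aeval_X,
        aeval_C]
      generalize algebraMap ℝ A c = a
      grind
    rw [parrondoComp, aeval_comp, h₁]
    simp only [parrondo, map_sub, map_add, map_neg, map_mul, map_pow, map_ofNat, aeval_X, aeval_C]
    generalize algebraMap ℝ A c = a
    grind
  | succ m ih =>
    rw [parrondoComp, aeval_comp, ih]
    simp only [parrondo, map_sub, map_mul, map_pow, aeval_X, aeval_C]
    generalize algebraMap ℝ A c = a
    grind

lemma X_pow_dvd_parrondoComp (c : ℝ) (m : ℕ) :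
    X ^ 6 ∣ (parrondoComp c m).comp (parrondoComp c m) - (X - C (-2 * c) * X ^ 5) := by
  refine X_pow_dvd_of_aeval_eq_zero fun A _ _ x hx => ?_
  have hy : (aeval x (parrondoComp c m)) ^ 6 = 0 := by
    rw [aeval_parrondoComp c m hx]
    generalize algebraMap ℝ A c = a
    grind
  rw [map_sub, aeval_comp, aeval_parrondoComp c m hy, aeval_parrondoComp c m hx]
  simp only [map_sub, map_neg, map_mul, map_pow, map_ofNat, aeval_X, aeval_C]
  generalize algebraMap ℝ A c = a
  grind

lemma compAll_diagMap_parrondo (n : ℕ) (c : ℝ) (m : ℕ) :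
    compAll (fun i : Fin (m + 3) => diagMap n (parrondo c i)) = diagMap n (parrondoComp c m) := by
  induction m with
  | zero =>
    funext x
    simp [compAll, List.ofFn_succ, parrondoComp, diagMap_comp]
  | succ m ih =>
    rw [parrondoComp, diagMap_comp, ← ih]
    funext x
    simp only [compAll]
    rw [List.ofFn_succ', List.concat_eq_append, List.foldl_append]
    rfl

lemma isLAS_parrondo (n : ℕ) {c : ℝ} (hc : 0 < c) (i : ℕ) :
    IsLAS (diagMap n (parrondo c i)) 0 := by
  obtain ⟨m, hm, hm₀, h⟩ := X_pow_dvd_parrondo c i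
  exact isLAS_diagMap (eval_zero_parrondo c i) (eventually_abs_eval_lt hm hm₀ (by linarith) h)

lemma isRepeller_parrondo (n : ℕ) {c : ℝ} (hc : c < 0) (i : ℕ) :
    IsRepeller (diagMap n (parrondo c i)) 0 := by
  obtain ⟨m, hm, -, h⟩ := X_pow_dvd_parrondo c i
  exact isRepeller_diagMap (eventually_lt_abs_eval hm (by linarith) h)

lemma isLAS_parrondoComp (n : ℕ) {c : ℝ} (hc : c < 0) (m : ℕ) :
    IsLAS (diagMap n (parrondoComp c m)) 0 :=
  isLAS_diagMap (eval_zero_parrondoComp c m) (eventually_abs_eval_lt (m := 4) (by decide)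
    (by decide) (by linarith) (X_pow_dvd_parrondoComp c m))

lemma isRepeller_parrondoComp (n : ℕ) {c : ℝ} (hc : 0 < c) (m : ℕ) :
    IsRepeller (diagMap n (parrondoComp c m)) 0 :=
  isRepeller_diagMap (eventually_lt_abs_eval (m := 4) (by decide) (by linarith)
    (X_pow_dvd_parrondoComp c m))

end Family

/-- for every `n ≥ 1` and `k ≥ 3` there are `k` polynomial maps of `ℝⁿ`
fixing `0`, LAS for each but with `0` a repeller for the composition; and also `k`
polynomial maps fixing `0`, repeller for each but with `0` LAS for the composition. -/
theorem stmt6 (n : ℕ) (hn : 1 ≤ n) (k : ℕ) (hk : 3 ≤ k) :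
    (∃ f : Fin k → EuclideanSpace ℝ (Fin n) → EuclideanSpace ℝ (Fin n),
      (∀ i, IsPolyMap (f i)) ∧ (∀ i, f i 0 = 0) ∧ (∀ i, IsLAS (f i) 0) ∧
      IsRepeller (compAll f) 0) ∧
    (∃ g : Fin k → EuclideanSpace ℝ (Fin n) → EuclideanSpace ℝ (Fin n),
      (∀ i, IsPolyMap (g i)) ∧ (∀ i, g i 0 = 0) ∧ (∀ i, IsRepeller (g i) 0) ∧
      IsLAS (compAll g) 0) := by
  obtain ⟨m, rfl⟩ := Nat.exists_eq_add_of_le' hk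
  refine ⟨⟨fun i => diagMap n (parrondo 1 i), fun i => isPolyMap_diagMap _,
    fun i => diagMap_zero (eval_zero_parrondo 1 i), fun i => isLAS_parrondo n one_pos i, ?_⟩,
    ⟨fun i => diagMap n (parrondo (-1) i), fun i => isPolyMap_diagMap _,
    fun i => diagMap_zero (eval_zero_parrondo (-1) i),
    fun i => isRepeller_parrondo n neg_one_lt_zero i, ?_⟩⟩
  · rw [compAll_diagMap_parrondo]
    exact isRepeller_parrondoComp n one_pos m
  · rw [compAll_diagMap_parrondo]
    exact isLAS_parrondoComp n neg_one_lt_zero m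
end
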